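/- Suppose 0 < a < 1, b < 1, and the peak powers P̄1 > 0 and P̄2 > 0 satisfy P̄1 ≥ (b−a)/(a·(1−b)). Then for all P1 ∈ [0, P̄1] and P2 ∈ [0, P̄2], Rs(P1,P2) ≤ Rs(P̄1, min(P̄2, P2*)); that is, the power pair (P̄1, min(P̄2, P2*)) maximizes the achievable secrecy rate over the power-constraint box. -/

import Mathlib

/-- `g x = (1/2) * log_2 (1 + x)`. -/
noncomputable def g (x : ℝ) : ℝ := (1 / 2) * Real.logb 2 (1 + x)

/-- The achievable secrecy rate `Rs(P1, P2)` for the Gaussian wiretap channel with a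
helping interferer, with channel gains `a`, `b` and powers `P1`, `P2`. -/
noncomputable def Rs (a b P1 P2 : ℝ) : ℝ :=
  if 1 + P2 ≤ a then 0
  else if 1 ≤ a then
    -- case `1 ≤ a < 1 + P2`
    if 1 + P1 ≤ b then g P1 - g (a * P1 / (1 + P2))
    else if 1 ≤ b then max 0 (g (P1 + b * P2) - g (a * P1 + P2))
    else max 0 (g (P1 / (1 + b * P2)) - g (a * P1 / (1 + P2)))
  else
    -- case `a < 1`, with `β1 = (1+P1)/(1+a*P1)` and `β2 = a*(1+P1)/(1+a*P1+(1-a)*P2)`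
    if 1 + P1 ≤ b then g P1 - g (a * P1 / (1 + P2))
    else if (1 + P1) / (1 + a * P1) ≤ b then g (P1 + b * P2) - g (a * P1 + P2)
    else if a * (1 + P1) / (1 + a * P1 + (1 - a) * P2) ≤ b then g P1 - g (a * P1)
    else g (P1 / (1 + b * P2)) - g (a * P1 / (1 + P2))

/-- The power threshold `P2* = (a - 1 + √((a-1)² + (1/b - a)(a - b + (1-b) a P̄1))) / (1 - a b)`. -/
noncomputable def P2star (a b Pbar1 : ℝ) : ℝ :=
  (a - 1 + Real.sqrt ((a - 1) ^ 2 + (1 / b - a) * (a - b + (1 - b) * a * Pbar1))) / (1 - a * b)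

lemma g_sub_le_g_sub {x y x' y' : ℝ} (hx : 0 ≤ x) (hy : 0 ≤ y) (hx' : 0 ≤ x') (hy' : 0 ≤ y')
    (h : (1 + x) * (1 + y') ≤ (1 + x') * (1 + y)) : g x - g y ≤ g x' - g y' := by
  have key : Real.logb 2 ((1 + x) * (1 + y')) ≤ Real.logb 2 ((1 + x') * (1 + y)) :=
    Real.logb_le_logb_of_le (by norm_num) (by positivity) h
  rw [Real.logb_mul (by positivity) (by positivity),
    Real.logb_mul (by positivity) (by positivity)] at key
  unfold g
  linarith

/-- The secrecy rate when the interference is treated as noise. -/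
noncomputable def noisyRate (a b P1 P2 : ℝ) : ℝ :=
  g (P1 / (1 + b * P2)) - g (a * P1 / (1 + P2))

lemma noisyRate_zero_right (a b P1 : ℝ) : noisyRate a b P1 0 = g P1 - g (a * P1) := by
  simp [noisyRate]

lemma noisyRate_le_noisyRate {a b p q p' q' : ℝ} (ha : 0 ≤ a) (hb : 0 ≤ b) (hp : 0 ≤ p)
    (hq : 0 ≤ q) (hp' : 0 ≤ p') (hq' : 0 ≤ q')
    (h : (1 + b * q + p) * (1 + q) * ((1 + b * q') * (1 + q' + a * p')) ≤
      (1 + b * q' + p') * (1 + q') * ((1 + b * q) * (1 + q + a * p))) :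
    noisyRate a b p q ≤ noisyRate a b p' q' := by
  refine g_sub_le_g_sub (by positivity) (by positivity) (by positivity) (by positivity) ?_
  have e1 : (1 + p / (1 + b * q)) * (1 + a * p' / (1 + q')) =
      ((1 + b * q + p) * (1 + q' + a * p')) / ((1 + b * q) * (1 + q')) := by
    field_simp
  have e2 : (1 + p' / (1 + b * q')) * (1 + a * p / (1 + q)) =
      ((1 + b * q' + p') * (1 + q + a * p)) / ((1 + b * q') * (1 + q)) := by
    field_simp
  rw [e1, e2, div_le_div_iff₀ (by positivity) (by positivity)]
  linarith

lemma noisyRate_mono_left {a b p p' q : ℝ} (ha0 : 0 ≤ a) (ha : a ≤ 1) (hb0 : 0 ≤ b) (hb : b ≤ 1)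
    (hp : 0 ≤ p) (hpp' : p ≤ p') (hq : 0 ≤ q) : noisyRate a b p q ≤ noisyRate a b p' q := by
  refine noisyRate_le_noisyRate ha0 hb0 hp hq (hp.trans hpp') hq ?_
  have hab : a * b ≤ 1 := mul_le_one₀ ha hb0 hb
  have h1 : 0 ≤ (1 - a) + (1 - a * b) * q :=
    add_nonneg (by linarith) (mul_nonneg (by linarith) hq)
  have h2 : 0 ≤ (1 + q) * (1 + b * q) * ((p' - p) * ((1 - a) + (1 - a * b) * q)) :=
    mul_nonneg (by positivity) (mul_nonneg (by linarith) h1)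
  linear_combination h2

lemma noisyRate_le_of_sign {a b p q m : ℝ} (ha0 : 0 ≤ a) (hb0 : 0 ≤ b) (hp : 0 ≤ p)
    (hq : 0 ≤ q) (hm : 0 ≤ m)
    (h : 0 ≤ (m - q) * (a - b + (1 - b) * a * p - (1 - a) * b * (m + q)
      - (1 - a * b) * b * (m * q))) :
    noisyRate a b p q ≤ noisyRate a b p m := by
  refine noisyRate_le_noisyRate ha0 hb0 hp hq hp hm ?_
  linear_combination mul_nonneg hp h

lemma P2star_nonneg {a b p : ℝ} (hb0 : 0 < b) (hab : a * b < 1)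
    (hK : 0 ≤ a - b + (1 - b) * a * p) : 0 ≤ P2star a b p := by
  have hv : 0 ≤ 1 / b - a := by
    rw [sub_nonneg, le_div_iff₀ hb0]
    exact hab.le
  refine div_nonneg ?_ (by linarith)
  have : 1 - a ≤ √((a - 1) ^ 2 + (1 / b - a) * (a - b + (1 - b) * a * p)) :=
    Real.le_sqrt_of_sq_le (by linarith [mul_nonneg hv hK])
  linarith

lemma P2star_root {a b p : ℝ} (hb0 : 0 < b) (hab : a * b < 1)
    (hK : 0 ≤ a - b + (1 - b) * a * p) :
    (1 - a * b) * b * P2star a b p ^ 2 + 2 * (1 - a) * b * P2star a b p =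
      a - b + (1 - b) * a * p := by
  have hv : 0 < 1 - a * b := by linarith
  have hv' : 0 ≤ 1 / b - a := by
    rw [sub_nonneg, le_div_iff₀ hb0]
    exact hab.le
  have hs : P2star a b p * (1 - a * b) =
      a - 1 + √((a - 1) ^ 2 + (1 / b - a) * (a - b + (1 - b) * a * p)) :=
    div_mul_cancel₀ _ hv.ne'
  have hsq := Real.sq_sqrt (add_nonneg (sq_nonneg (a - 1)) (mul_nonneg hv' hK))
  rw [← sub_eq_iff_eq_add'.mpr hs] at hsq
  have hbv : b * (1 / b - a) = 1 - a * b := by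
    field_simp
  refine mul_left_cancel₀ hv.ne' ?_
  linear_combination b * hsq + (a - b + (1 - b) * a * p) * hbv

lemma noisyRate_le_noisyRate_min_P2star {a b p q Q : ℝ} (ha0 : 0 ≤ a) (ha : a < 1) (hb0 : 0 < b)
    (hb : b < 1) (hp : 0 ≤ p) (hK : 0 ≤ a - b + (1 - b) * a * p) (hq : 0 ≤ q) (hqQ : q ≤ Q) :
    noisyRate a b p q ≤ noisyRate a b p (min Q (P2star a b p)) := by
  have hab : a * b < 1 := mul_lt_one_of_nonneg_of_lt_one_left ha0 ha hb.le
  have hs := P2star_nonneg hb0 hab hK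
  have hroot := P2star_root hb0 hab hK
  have hu : 0 ≤ (1 - a) * b := mul_nonneg (by linarith) hb0.le
  have hv : 0 ≤ (1 - a * b) * b := mul_nonneg (by linarith) hb0.le
  generalize P2star a b p = s at *
  have hm : 0 ≤ min Q s := le_min (hq.trans hqQ) hs
  refine noisyRate_le_of_sign ha0 hb0.le hp hq hm ?_
  rw [← hroot]
  rcases le_total q s with hqs | hsq
  · have hms : min Q s ≤ s := min_le_right _ _
    have hqm : q ≤ min Q s := le_min hqQ hqs
    refine mul_nonneg (by linarith) ?_
    have h1 : min Q s * q ≤ s * s := mul_le_mul hms hqs hq hs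
    have h2 := mul_le_mul_of_nonneg_left h1 hv
    have h3 := mul_le_mul_of_nonneg_left (add_le_add hms hqs) hu
    linarith
  · rw [min_eq_right (hsq.trans hqQ)]
    have h1 : 0 ≤ (1 - a) * b + (1 - a * b) * b * s := by positivity
    linear_combination mul_nonneg (sq_nonneg (q - s)) h1

lemma Rs_of_lt_one {a b P1 P2 : ℝ} (ha0 : 0 ≤ a) (ha : a < 1) (hb : b < 1) (hP1 : 0 ≤ P1)
    (hP2 : 0 ≤ P2) :
    Rs a b P1 P2 = if a * (1 + P1) / (1 + a * P1 + (1 - a) * P2) ≤ b then noisyRate a b P1 0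
      else noisyRate a b P1 P2 := by
  have hβ : ¬ (1 + P1) / (1 + a * P1) ≤ b := by
    rw [not_le, lt_div_iff₀ (by positivity)]
    nlinarith [mul_nonneg ha0 hP1, mul_nonneg (sub_nonneg.mpr ha.le) hP1]
  rw [Rs, if_neg (by linarith), if_neg (by linarith), if_neg (by linarith), if_neg hβ,
    noisyRate_zero_right, noisyRate]

lemma noisyRate_le_Rs {a b P1 P2 : ℝ} (ha0 : 0 ≤ a) (ha : a < 1) (hb0 : 0 ≤ b) (hb : b < 1)
    (hP1 : 0 ≤ P1) (hP2 : 0 ≤ P2) : noisyRate a b P1 P2 ≤ Rs a b P1 P2 := by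
  rw [Rs_of_lt_one ha0 ha hb hP1 hP2]
  split_ifs with hβ
  · have hd : 0 < 1 + a * P1 + (1 - a) * P2 := by
      have := mul_nonneg (sub_nonneg.mpr ha.le) hP2
      positivity
    rw [div_le_iff₀ hd] at hβ
    refine noisyRate_le_of_sign ha0 hb0 hP1 hP2 le_rfl ?_
    linear_combination mul_nonneg hP2 (sub_nonneg.mpr hβ)
  · exact le_rfl

/-- If `0 < a < 1`, `0 < b < 1` and `P̄1 ≥ (b-a)/(a(1-b))`, the power pair
`(P̄1, min P̄2 P2*)` maximizes the achievable secrecy rate over the box `[0,P̄1] × [0,P̄2]`. -/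
theorem stmt13 (a b Pbar1 Pbar2 : ℝ) (ha0 : 0 < a) (ha : a < 1) (hb0 : 0 < b) (hb : b < 1)
    (hPbar1 : 0 < Pbar1) (hPbar2 : 0 < Pbar2) (h : (b - a) / (a * (1 - b)) ≤ Pbar1) :
    ∀ P1 ∈ Set.Icc (0 : ℝ) Pbar1, ∀ P2 ∈ Set.Icc (0 : ℝ) Pbar2,
      Rs a b P1 P2 ≤ Rs a b Pbar1 (min Pbar2 (P2star a b Pbar1)) := by
  rintro P1 ⟨hP1, hP1'⟩ P2 ⟨hP2, hP2'⟩
  have hK : 0 ≤ a - b + (1 - b) * a * Pbar1 := by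
    rw [div_le_iff₀ (mul_pos ha0 (by linarith))] at h
    linarith
  have hab : a * b < 1 := mul_lt_one_of_nonneg_of_lt_one_left ha0.le ha hb.le
  have hs := P2star_nonneg hb0 hab hK
  have bound {q : ℝ} (hq : 0 ≤ q) (hq' : q ≤ Pbar2) :
      noisyRate a b P1 q ≤ Rs a b Pbar1 (min Pbar2 (P2star a b Pbar1)) :=
    (noisyRate_mono_left ha0.le ha.le hb0.le hb.le hP1 hP1' hq).trans <|
      (noisyRate_le_noisyRate_min_P2star ha0.le ha hb0 hb hPbar1.le hK hq hq').trans <|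
        noisyRate_le_Rs ha0.le ha hb0.le hb hPbar1.le (le_min hPbar2.le hs)
  rw [Rs_of_lt_one ha0.le ha hb hP1 hP2]
  split_ifs
  · exact bound le_rfl hPbar2.le
  · exact bound hP2 hP2'
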